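/- arXiv:math/0304451 — 7 statements merged into one kernel-verified Lean document; each statement's English description precedes it below -/
import Mathlib

section
/- Let f : X → X be a homeomorphism of a compact metric space X and let 𝒞 be a nonempty family of transitive (nonempty compact invariant) subsets of X that is totally ordered by inclusion. Then the closure of the union ⋃_{K ∈ 𝒞} K is a nonempty compact invariant transitive set. -/
/-- A nonempty compact invariant set `K` of a homeomorphism `f` is *transitive* if for every
pair of nonempty relatively open subsets `U`, `V` of `K` there is `n > 0` with
`f^n(U) ∩ V ≠ ∅`. -/
def IsTransitiveSet {X : Type*} [MetricSpace X] (f : X ≃ₜ X) (K : Set X) : Prop :=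
  K.Nonempty ∧ IsCompact K ∧ f '' K = K ∧
    ∀ U V : Set X, IsOpen U → IsOpen V → (K ∩ U).Nonempty → (K ∩ V).Nonempty →
      ∃ n : ℕ, 0 < n ∧ ((⇑f)^[n] '' (K ∩ U) ∩ (K ∩ V)).Nonempty

/-- The closure of the union of a nonempty family of transitive sets which is totally
ordered by inclusion is again a (nonempty compact invariant) transitive set. -/
theorem closure_sUnion_chain_transitive {X : Type*} [MetricSpace X] [CompactSpace X]
    (f : X ≃ₜ X) (𝒞 : Set (Set X)) (hne : 𝒞.Nonempty)
    (htrans : ∀ K ∈ 𝒞, IsTransitiveSet f K) (hchain : IsChain (· ⊆ ·) 𝒞) :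
    IsTransitiveSet f (closure (⋃₀ 𝒞)) := by
  have key : ∀ U V : Set X, IsOpen U → IsOpen V → (closure (⋃₀ 𝒞) ∩ U).Nonempty →
      (closure (⋃₀ 𝒞) ∩ V).Nonempty → ∃ K ∈ 𝒞, (K ∩ U).Nonempty ∧ (K ∩ V).Nonempty := by
    intro U V hU hV hKU hKV
    obtain ⟨x, ⟨K, hK, hxK⟩, hxU⟩ := (closure_inter_open_nonempty_iff hU).1 hKU
    obtain ⟨y, ⟨L, hL, hyL⟩, hyV⟩ := (closure_inter_open_nonempty_iff hV).1 hKV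
    rcases hchain.total hK hL with hKL | hLK
    · exact ⟨L, hL, ⟨x, hKL hxK, hxU⟩, ⟨y, hyL, hyV⟩⟩
    · exact ⟨K, hK, ⟨x, hxK, hxU⟩, ⟨y, hLK hyL, hyV⟩⟩
  refine ⟨?_, isClosed_closure.isCompact, ?_, ?_⟩
  · obtain ⟨K, hK⟩ := hne
    obtain ⟨x, hx⟩ := (htrans K hK).1
    exact ⟨x, subset_closure ⟨K, hK, hx⟩⟩
  · rw [f.image_closure, Set.image_sUnion, Set.sUnion_image, Set.sUnion_eq_biUnion]
    exact congrArg closure (Set.iUnion₂_congr fun K hK => (htrans K hK).2.2.1)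
  · intro U V hU hV hKU hKV
    obtain ⟨K, hK, hKU', hKV'⟩ := key U V hU hV hKU hKV
    obtain ⟨n, hn, hUV⟩ := (htrans K hK).2.2.2 U V hU hV hKU' hKV'
    have hsub : K ⊆ closure (⋃₀ 𝒞) := (Set.subset_sUnion_of_mem hK).trans subset_closure
    exact ⟨n, hn, hUV.mono (by gcongr)⟩
end

section
/- Let f : X → X be a homeomorphism of a compact metric space X. Then every transitive set of f is contained in a maximal transitive set, i.e., for every transitive set K there exists a transitive set L ⊇ K such that every transitive set containing L is equal to L. -/
/-- The closure of the union of a nonempty chain of transitive sets is transitive. -/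
theorem isTransitiveSet_closure_sUnion {X : Type*} [MetricSpace X] [CompactSpace X]
    (f : X ≃ₜ X) {c : Set (Set X)} (hc : ∀ A ∈ c, IsTransitiveSet f A)
    (hchain : IsChain (· ⊆ ·) c) (hne : c.Nonempty) :
    IsTransitiveSet f (closure (⋃₀ c)) := by
  have meets : ∀ U : Set X, IsOpen U → (closure (⋃₀ c) ∩ U).Nonempty →
      ∃ A ∈ c, (A ∩ U).Nonempty := by
    rintro U hU ⟨x, hx, hxU⟩
    obtain ⟨y, hyU, A, hA, hyA⟩ := mem_closure_iff.1 hx U hU hxU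
    exact ⟨A, hA, y, hyA, hyU⟩
  have sub : ∀ A ∈ c, A ⊆ closure (⋃₀ c) := fun A hA =>
    (Set.subset_sUnion_of_mem hA).trans subset_closure
  refine ⟨?_, isClosed_closure.isCompact, ?_, ?_⟩
  · obtain ⟨A, hA⟩ := hne
    exact (hc A hA).1.mono (sub A hA)
  · rw [f.image_closure, Set.sUnion_eq_biUnion, Set.image_iUnion₂]
    congr 1
    exact Set.iUnion₂_congr fun A hA => (hc A hA).2.2.1
  · intro U V hU hV hUne hVne
    obtain ⟨A, hA, hAU⟩ := meets U hU hUne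
    obtain ⟨B, hB, hBV⟩ := meets V hV hVne
    obtain ⟨C, hC, hAC, hBC⟩ := hchain.directedOn A hA B hB
    obtain ⟨n, hn, h⟩ := (hc C hC).2.2.2 U V hU hV
      (hAU.mono (Set.inter_subset_inter_left U hAC))
      (hBV.mono (Set.inter_subset_inter_left V hBC))
    exact ⟨n, hn, h.mono (Set.inter_subset_inter
      (Set.image_mono (Set.inter_subset_inter_left U (sub C hC)))
      (Set.inter_subset_inter_left V (sub C hC)))⟩

/-- Every transitive set of a homeomorphism of a compact metric space is contained in a
maximal transitive set. -/
theorem exists_maximal_transitive {X : Type*} [MetricSpace X] [CompactSpace X]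
    (f : X ≃ₜ X) (K : Set X) (hK : IsTransitiveSet f K) :
    ∃ L : Set X, IsTransitiveSet f L ∧ K ⊆ L ∧
      ∀ L' : Set X, IsTransitiveSet f L' → L ⊆ L' → L' = L := by
  obtain ⟨L, hKL, hL⟩ := zorn_subset_nonempty {A | IsTransitiveSet f A}
    (fun c hc hchain hne => ⟨closure (⋃₀ c),
      isTransitiveSet_closure_sUnion f hc hchain hne, fun A hA =>
        (Set.subset_sUnion_of_mem hA).trans subset_closure⟩) K hK
  exact ⟨L, hL.prop, hKL, fun L' hL' hLL' => (hL.le_of_ge hL' hLL').antisymm hLL'⟩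
end

section
/- Let f : X → X be a homeomorphism of a compact metric space X, let (t_n) be a strictly increasing sequence of positive integers with t_n dividing t_{n+1}, and let (D_n) be a decreasing sequence of nonempty compact subsets of X (D_{n+1} ⊆ D_n) such that for each n: f^{t_n}(D_n) ⊆ D_n; the sets D_n, f(D_n), …, f^{t_n − 1}(D_n) are pairwise disjoint; and max_{0 ≤ k < t_n} diam(f^k(D_n)) → 0 as n → ∞. Set Λ_n = ⋃_{0 ≤ k < t_n} f^k(D_n) and Λ = ⋂_{m ≥ 0} f^m(⋂_n Λ_n). Then Λ is a nonempty compact invariant set, and every point of Λ has dense forward orbit in Λ; in particular Λ is transitive. -/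
/-- If `g` maps the nonempty compact set `L` into itself, the intersection of the forward images
of `L` is nonempty, compact and invariant. -/
theorem Homeomorph.iInter_iterate_image_of_image_subset {X : Type*} [TopologicalSpace X]
    [T2Space X] (g : X ≃ₜ X) {L : Set X} (hne : L.Nonempty) (hL : IsCompact L)
    (hgL : g '' L ⊆ L) :
    (⋂ m : ℕ, (⇑g)^[m] '' L).Nonempty ∧ IsCompact (⋂ m : ℕ, (⇑g)^[m] '' L) ∧
      g '' (⋂ m : ℕ, (⇑g)^[m] '' L) = ⋂ m : ℕ, (⇑g)^[m] '' L := by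
  have hcpt : ∀ m : ℕ, IsCompact ((⇑g)^[m] '' L) := fun m =>
    hL.image (g.continuous.iterate m)
  have hdec : ∀ m : ℕ, (⇑g)^[m + 1] '' L ⊆ (⇑g)^[m] '' L := fun m => by
    rw [Function.iterate_succ, Set.image_comp]
    exact Set.image_mono hgL
  refine ⟨?_, ?_, ?_⟩
  · exact IsCompact.nonempty_iInter_of_sequence_nonempty_isCompact_isClosed _ hdec
      (fun m => hne.image _) (hcpt 0) (fun m => (hcpt m).isClosed)
  · exact (hcpt 0).of_isClosed_subset (isClosed_iInter fun m => (hcpt m).isClosed)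
      (Set.iInter_subset _ 0)
  · rw [Set.image_iInter g.bijective]
    have hsucc : ∀ m : ℕ, g '' ((⇑g)^[m] '' L) = (⇑g)^[m + 1] '' L := fun m => by
      rw [Function.iterate_succ', Set.image_comp]
    simp only [hsucc]
    refine Set.Subset.antisymm (Set.subset_iInter fun m => ?_)
      (Set.subset_iInter fun m => Set.iInter_subset _ (m + 1))
    exact (Set.iInter_subset _ m).trans (hdec m)

/-- If `g^[t]` maps `A` into itself, the images of `A` under iterates of `g` are controlled by
the exponent modulo `t`. -/
theorem Set.image_iterate_subset_image_iterate_mod {X : Type*} {g : X → X} {t : ℕ} {A : Set X}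
    (h : g^[t] '' A ⊆ A) (k : ℕ) : g^[k] '' A ⊆ g^[k % t] '' A := by
  have hmaps : Set.MapsTo (g^[t])^[k / t] A A := (Set.mapsTo_iff_image_subset.2 h).iterate _
  rintro _ ⟨a, ha, rfl⟩
  refine ⟨_, hmaps ha, ?_⟩
  rw [← Function.iterate_mul, ← Function.iterate_add_apply, Nat.mod_add_div]

/-- The intersection of a nested sequence of periodic unions of disks (with periods
`t n` dividing each other and diameters of the iterates going to `0`) is a nonempty
compact invariant set on which every point has dense forward orbit; in particular
it is a transitive set (an "adding machine"/odometer). -/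
theorem adding_machine_transitive {X : Type*} [MetricSpace X] [CompactSpace X]
    (f : X ≃ₜ X) (t : ℕ → ℕ) (ht0 : ∀ n, 0 < t n) (htmono : StrictMono t)
    (htdvd : ∀ n, t n ∣ t (n + 1))
    (D : ℕ → Set X) (hDne : ∀ n, (D n).Nonempty) (hDcpt : ∀ n, IsCompact (D n))
    (hDdec : ∀ n, D (n + 1) ⊆ D n)
    (hDper : ∀ n, (⇑f)^[t n] '' D n ⊆ D n)
    (hDdisj : ∀ n, ∀ i < t n, ∀ j < t n, i ≠ j →
      Disjoint ((⇑f)^[i] '' D n) ((⇑f)^[j] '' D n))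
    (hdiam : Filter.Tendsto
      (fun n : ℕ => ⨆ k : Fin (t n), Metric.diam ((⇑f)^[(k : ℕ)] '' D n))
      Filter.atTop (nhds 0))
    (Λn : ℕ → Set X) (hΛn : ∀ n, Λn n = ⋃ k ∈ Finset.range (t n), (⇑f)^[k] '' D n)
    (Λ : Set X) (hΛ : Λ = ⋂ m : ℕ, (⇑f)^[m] '' ⋂ n, Λn n) :
    Λ.Nonempty ∧ IsCompact Λ ∧ f '' Λ = Λ ∧
      (∀ x ∈ Λ, Λ ⊆ closure (Set.range fun n : ℕ => (⇑f)^[n] x)) ∧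
      IsTransitiveSet f Λ := by
  have hmod : ∀ n k, (⇑f)^[k] '' D n ⊆ Λn n := fun n k => by
    rw [hΛn]
    exact (Set.image_iterate_subset_image_iterate_mod (hDper n) k).trans
      (Set.subset_biUnion_of_mem (u := fun k => (⇑f)^[k] '' D n)
        (Finset.mem_coe.2 (Finset.mem_range.2 (Nat.mod_lt k (ht0 n)))))
  have hΛn_cpt : ∀ n, IsCompact (Λn n) := fun n => by
    rw [hΛn]
    exact (Finset.range (t n)).isCompact_biUnion fun k _ => (hDcpt n).image (f.continuous.iterate k)
  have hΛn_dec : ∀ n, Λn (n + 1) ⊆ Λn n := fun n => by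
    rw [hΛn (n + 1)]
    exact Set.iUnion₂_subset fun k _ => (Set.image_mono (hDdec n)).trans (hmod n k)
  have hΛn_ne : ∀ n, (Λn n).Nonempty := fun n => ((hDne n).image _).mono (hmod n 0)
  have hΛn_fwd : ∀ n, Set.MapsTo f (Λn n) (Λn n) := fun n x hx => by
    rw [hΛn] at hx
    obtain ⟨k, -, a, ha, rfl⟩ := Set.mem_iUnion₂.1 hx
    exact hmod n (k + 1) ⟨a, ha, Function.iterate_succ_apply' _ _ _⟩
  have hL_ne : (⋂ n, Λn n).Nonempty :=
    IsCompact.nonempty_iInter_of_sequence_nonempty_isCompact_isClosed _ hΛn_dec hΛn_ne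
      (hΛn_cpt 0) fun n => (hΛn_cpt n).isClosed
  have hL_cpt : IsCompact (⋂ n, Λn n) :=
    (isClosed_iInter fun n => (hΛn_cpt n).isClosed).isCompact
  have hL_fwd : f '' (⋂ n, Λn n) ⊆ ⋂ n, Λn n := by
    rintro _ ⟨x, hx, rfl⟩
    exact Set.mem_iInter.2 fun n => hΛn_fwd n (Set.mem_iInter.1 hx n)
  obtain ⟨hne, hcpt, hinv⟩ := f.iInter_iterate_image_of_image_subset hL_ne hL_cpt hL_fwd
  rw [← hΛ] at hne hcpt hinv
  have hΛ_sub : ∀ n, Λ ⊆ Λn n := fun n x hx => by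
    rw [hΛ] at hx
    obtain ⟨y, hy, rfl⟩ := Set.mem_iInter.1 hx 0
    exact Set.mem_iInter.1 hy n
  have hclose : ∀ x ∈ Λ, ∀ y ∈ Λ, ∀ ε > 0, ∃ i : ℕ, 0 < i ∧ dist y ((⇑f)^[i] x) < ε := by
    intro x hx y hy ε hε
    obtain ⟨n, hn⟩ := (hdiam.eventually_lt_const hε).exists
    have hxn := hΛ_sub n hx
    have hyn := hΛ_sub n hy
    rw [hΛn] at hxn hyn
    obtain ⟨j, hj, a, ha, rfl⟩ := Set.mem_iUnion₂.1 hxn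
    obtain ⟨k, hk, hyk⟩ := Set.mem_iUnion₂.1 hyn
    rw [Finset.mem_range] at hj hk
    refine ⟨k + t n - j, by omega, lt_of_le_of_lt ?_ hn⟩
    have hmem : (⇑f)^[k + t n - j] ((⇑f)^[j] a) ∈ (⇑f)^[k] '' D n := by
      rw [← Function.iterate_add_apply, Nat.sub_add_cancel (by omega), Function.iterate_add_apply]
      exact Set.mem_image_of_mem _ (hDper n (Set.mem_image_of_mem _ ha))
    exact (Metric.dist_le_diam_of_mem
      ((hDcpt n).image (f.continuous.iterate k)).isBounded hyk hmem).trans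
      (le_ciSup (f := fun k : Fin (t n) => Metric.diam ((⇑f)^[(k : ℕ)] '' D n))
        (Set.finite_range _).bddAbove ⟨k, hk⟩)
  refine ⟨hne, hcpt, hinv, fun x hx y hy => Metric.mem_closure_range_iff.2 fun ε hε => ?_,
    hne, hcpt, hinv, fun U V _ hV ⟨x, hx, hxU⟩ ⟨y, hy, hyV⟩ => ?_⟩
  · obtain ⟨i, -, hi⟩ := hclose x hx y hy ε hε
    exact ⟨i, hi⟩
  · obtain ⟨ε, hε, hball⟩ := Metric.isOpen_iff.1 hV y hyV
    obtain ⟨i, hi0, hi⟩ := hclose x hx y hy ε hε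
    exact ⟨i, hi0, _, Set.mem_image_of_mem _ ⟨hx, hxU⟩,
      (Set.mapsTo_iff_image_subset.2 hinv.subset).iterate i hx, hball (Metric.mem_ball'.2 hi)⟩
end

section
/- Let f : X → X be a homeomorphism of a compact metric space X, let (t_n) be a strictly increasing sequence of positive integers with t_n dividing t_{n+1}, and let (D_n) be a decreasing sequence of nonempty compact subsets of X (D_{n+1} ⊆ D_n) such that for each n: f^{t_n}(D_n) ⊆ D_n; the sets D_n, f(D_n), …, f^{t_n − 1}(D_n) are pairwise disjoint; and max_{0 ≤ k < t_n} diam(f^k(D_n)) → 0 as n → ∞. Set Λ_n = ⋃_{0 ≤ k < t_n} f^k(D_n) and Λ = ⋂_{m ≥ 0} f^m(⋂_n Λ_n). Then Λ contains no periodic point of f: there is no x ∈ Λ and integer p > 0 with f^p(x) = x. -/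
/-- If `f^[t]` maps `D` into itself, the `k`-th iterate of `D` lies in the
`k % t`-th one. -/
theorem Set.MapsTo.image_iterate_subset_mod {X : Type*} {f : X → X} {t : ℕ} {D : Set X}
    (h : Set.MapsTo f^[t] D D) (k : ℕ) : f^[k] '' D ⊆ f^[k % t] '' D := by
  rintro _ ⟨d, hd, rfl⟩
  refine ⟨(f^[t])^[k / t] d, h.iterate (k / t) hd, ?_⟩
  rw [← Function.iterate_mul, ← Function.iterate_add_apply, Nat.mod_add_div]

/-- If the first `t` iterates of `D` are pairwise disjoint and `f^[t]` maps `D` into itself,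
then no point of their union is fixed by `f^[p]` with `0 < p < t`. -/
theorem iterate_ne_self_of_disjoint_images {X : Type*} {f : X → X} {t p k : ℕ} {D : Set X}
    (hD : Set.MapsTo f^[t] D D)
    (hdisj : ∀ i < t, ∀ j < t, i ≠ j → Disjoint (f^[i] '' D) (f^[j] '' D))
    (hp : 0 < p) (hpt : p < t) (hk : k < t) {x : X} (hx : x ∈ f^[k] '' D) :
    f^[p] x ≠ x := by
  intro hfix
  have hmem : x ∈ f^[(p + k) % t] '' D := by
    apply hD.image_iterate_subset_mod
    obtain ⟨d, hd, rfl⟩ := hx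
    exact ⟨d, hd, by rw [Function.iterate_add_apply, hfix]⟩
  have hne : k ≠ (p + k) % t := by
    rcases lt_or_ge (p + k) t with h | h
    · rw [Nat.mod_eq_of_lt h]
      omega
    · rw [Nat.mod_eq_sub_mod h, Nat.mod_eq_of_lt (by omega)]
      omega
  exact (hdisj k hk _ (Nat.mod_lt _ (by omega)) hne).ne_of_mem hx hmem rfl


/-- The intersection of a nested sequence of periodic unions of disks (with periods
`t n` dividing each other, strictly increasing, and diameters of the iterates going
to `0`) contains no periodic point of `f`. -/
theorem adding_machine_no_periodic_point {X : Type*} [MetricSpace X] [CompactSpace X]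
    (f : X ≃ₜ X) (t : ℕ → ℕ) (ht0 : ∀ n, 0 < t n) (htmono : StrictMono t)
    (htdvd : ∀ n, t n ∣ t (n + 1))
    (D : ℕ → Set X) (hDne : ∀ n, (D n).Nonempty) (hDcpt : ∀ n, IsCompact (D n))
    (hDdec : ∀ n, D (n + 1) ⊆ D n)
    (hDper : ∀ n, (⇑f)^[t n] '' D n ⊆ D n)
    (hDdisj : ∀ n, ∀ i < t n, ∀ j < t n, i ≠ j →
      Disjoint ((⇑f)^[i] '' D n) ((⇑f)^[j] '' D n))
    (hdiam : Filter.Tendsto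
      (fun n : ℕ => ⨆ k : Fin (t n), Metric.diam ((⇑f)^[(k : ℕ)] '' D n))
      Filter.atTop (nhds 0))
    (Λn : ℕ → Set X) (hΛn : ∀ n, Λn n = ⋃ k ∈ Finset.range (t n), (⇑f)^[k] '' D n)
    (Λ : Set X) (hΛ : Λ = ⋂ m : ℕ, (⇑f)^[m] '' ⋂ n, Λn n) :
    ¬ ∃ x ∈ Λ, ∃ p : ℕ, 0 < p ∧ (⇑f)^[p] x = x := by
  rintro ⟨x, hx, p, hp, hfix⟩
  rw [hΛ] at hx
  have hx0 : x ∈ ⋂ n, Λn n := by simpa using Set.mem_iInter.mp hx 0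
  have hmem := Set.mem_iInter.mp hx0 (p + 1)
  rw [hΛn] at hmem
  simp only [Set.mem_iUnion, Finset.mem_range] at hmem
  obtain ⟨k, hk, hxk⟩ := hmem
  exact iterate_ne_self_of_disjoint_images (Set.mapsTo_iff_image_subset.mpr (hDper (p + 1)))
    (hDdisj (p + 1)) hp (htmono.le_apply (x := p + 1)) hk hxk hfix
end

section
/- Let f : X → X be a homeomorphism of a compact metric space X, let (t_n) be a strictly increasing sequence of positive integers with t_n dividing t_{n+1}, and let (D_n) be a decreasing sequence of nonempty compact subsets of X (D_{n+1} ⊆ D_n) such that for each n: f^{t_n}(D_n) is contained in the interior of D_n; the sets D_n, f(D_n), …, f^{t_n − 1}(D_n) are pairwise disjoint; and max_{0 ≤ k < t_n} diam(f^k(D_n)) → 0 as n → ∞. Set Λ_n = ⋃_{0 ≤ k < t_n} f^k(D_n) and Λ = ⋂_{m ≥ 0} f^m(⋂_n Λ_n). Then Λ is Lyapunov stable for f: for every open set U containing Λ there is an open set V with Λ ⊆ V and f^k(V) ⊆ U for all k ≥ 0. -/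
/-- A closed set `A` is *Lyapunov stable* for a homeomorphism `f` if every open
neighborhood `U` of `A` contains an open neighborhood `V` of `A` all of whose forward
iterates remain in `U`. -/
def LyapunovStable {X : Type*} [MetricSpace X] (f : X ≃ₜ X) (A : Set X) : Prop :=
  ∀ U : Set X, IsOpen U → A ⊆ U →
    ∃ V : Set X, IsOpen V ∧ A ⊆ V ∧ ∀ k : ℕ, (⇑f)^[k] '' V ⊆ U

/-- Iterates of an open map are open maps. -/
theorem IsOpenMap.iterate {X : Type*} [TopologicalSpace X] {f : X → X} (hf : IsOpenMap f)
    (n : ℕ) : IsOpenMap f^[n] := by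
  induction n with
  | zero => exact IsOpenMap.id
  | succ n ih => exact ih.comp hf

open Set Function in
/-- The intersection of a decreasing sequence of compact forward-invariant neighborhoods of
itself is Lyapunov stable. -/
theorem LyapunovStable.of_eq_iInter {X : Type*} [MetricSpace X] {f : X ≃ₜ X} {A : Set X}
    {L : ℕ → Set X} (hA : A = ⋂ n, L n) (hL : Antitone L) (hc : ∀ n, IsCompact (L n))
    (hf : ∀ n, MapsTo f (L n) (L n)) (hint : ∀ n, A ⊆ interior (L n)) :
    LyapunovStable f A := by
  intro U hU hAU
  obtain ⟨n, hn⟩ := exists_subset_nhds_of_isCompact hL.directed_ge hc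
    (fun x hx => hU.mem_nhds (hAU (hA ▸ hx)))
  refine ⟨interior (L n), isOpen_interior, hint n, fun k => ?_⟩
  exact (image_mono interior_subset).trans (((hf n).iterate k).image_subset.trans hn)

open Set Function in
/-- If `f^[t]` maps `D` into itself, the union of the first `t` iterates of `D` is
forward invariant. -/
theorem mapsTo_biUnion_iterate {X : Type*} {f : X → X} {t : ℕ} {D : Set X}
    (hD : MapsTo f^[t] D D) :
    MapsTo f (⋃ k ∈ Finset.range t, f^[k] '' D) (⋃ k ∈ Finset.range t, f^[k] '' D) := by
  intro x hx
  simp only [mem_iUnion, Finset.mem_range, exists_prop] at hx ⊢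
  obtain ⟨k, hk, y, hy, rfl⟩ := hx
  rcases Nat.lt_or_ge (k + 1) t with h | h
  · exact ⟨k + 1, h, y, hy, iterate_succ_apply' f k y⟩
  · obtain rfl : t = k + 1 := by omega
    exact ⟨0, k.succ_pos, _, hD hy, iterate_succ_apply' f k y⟩

open Set Function in
/-- If `f^[t]` maps `D` into its interior, then it maps the union of the first `t` iterates
of `D` into its interior. -/
theorem mapsTo_iterate_biUnion_interior {X : Type*} [TopologicalSpace X] (f : X ≃ₜ X) {t : ℕ}
    {D : Set X} (hD : MapsTo f^[t] D (interior D)) :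
    MapsTo f^[t] (⋃ k ∈ Finset.range t, f^[k] '' D)
      (interior (⋃ k ∈ Finset.range t, f^[k] '' D)) := by
  intro x hx
  simp only [mem_iUnion, exists_prop] at hx
  obtain ⟨k, hk, y, hy, rfl⟩ := hx
  refine interior_mono (subset_biUnion_of_mem (u := fun k => f^[k] '' D) hk)
    ((f.isOpenMap.iterate k).image_interior_subset D ⟨f^[t] y, hD hy, ?_⟩)
  rw [← iterate_add_apply, ← iterate_add_apply, add_comm]

open Set Function in
/-- If `D ⊆ E`, any union of iterates of `D` lies in the union of the first `t` iterates of `E`,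
provided `f^[t]` maps `E` into itself. -/
theorem biUnion_iterate_subset {X : Type*} {f : X → X} {s t : ℕ} (ht : 0 < t) {D E : Set X}
    (hDE : D ⊆ E) (hE : MapsTo f^[t] E E) :
    (⋃ k ∈ Finset.range s, f^[k] '' D) ⊆ ⋃ k ∈ Finset.range t, f^[k] '' E := by
  refine iUnion₂_subset fun k _ => ?_
  rintro _ ⟨y, hy, rfl⟩
  refine (mapsTo_biUnion_iterate hE).iterate k ?_
  exact mem_biUnion (Finset.mem_coe.2 (Finset.mem_range.2 ht)) ⟨y, hDE hy, rfl⟩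

open Set Function in
/-- Iterated images of a forward-invariant set decrease. -/
theorem antitone_iterate_image {X : Type*} {f : X → X} {S : Set X} (hS : MapsTo f S S) :
    Antitone fun m : ℕ => f^[m] '' S := by
  refine antitone_nat_of_succ_le fun m => ?_
  rintro _ ⟨y, hy, rfl⟩
  exact ⟨f y, hS hy, rfl⟩

/-- If each `f^{t n}(D n)` is contained in the interior of `D n`, the intersection `Λ` of
the nested sequence of periodic unions of disks is Lyapunov stable for `f`. -/
theorem adding_machine_lyapunov_stable {X : Type*} [MetricSpace X] [CompactSpace X]
    (f : X ≃ₜ X) (t : ℕ → ℕ) (ht0 : ∀ n, 0 < t n) (htmono : StrictMono t)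
    (htdvd : ∀ n, t n ∣ t (n + 1))
    (D : ℕ → Set X) (hDne : ∀ n, (D n).Nonempty) (hDcpt : ∀ n, IsCompact (D n))
    (hDdec : ∀ n, D (n + 1) ⊆ D n)
    (hDper : ∀ n, (⇑f)^[t n] '' D n ⊆ interior (D n))
    (hDdisj : ∀ n, ∀ i < t n, ∀ j < t n, i ≠ j →
      Disjoint ((⇑f)^[i] '' D n) ((⇑f)^[j] '' D n))
    (hdiam : Filter.Tendsto
      (fun n : ℕ => ⨆ k : Fin (t n), Metric.diam ((⇑f)^[(k : ℕ)] '' D n))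
      Filter.atTop (nhds 0))
    (Λn : ℕ → Set X) (hΛn : ∀ n, Λn n = ⋃ k ∈ Finset.range (t n), (⇑f)^[k] '' D n)
    (Λ : Set X) (hΛ : Λ = ⋂ m : ℕ, (⇑f)^[m] '' ⋂ n, Λn n) :
    LyapunovStable f Λ := by
  have hmaps n : Set.MapsTo (⇑f)^[t n] (D n) (interior (D n)) :=
    Set.mapsTo_iff_image_subset.2 (hDper n)
  have hself n : Set.MapsTo (⇑f)^[t n] (D n) (D n) := (hmaps n).mono_right interior_subset
  have hinv n : Set.MapsTo f (Λn n) (Λn n) := hΛn n ▸ mapsTo_biUnion_iterate (hself n)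
  have hint n : Set.MapsTo (⇑f)^[t n] (Λn n) (interior (Λn n)) :=
    hΛn n ▸ mapsTo_iterate_biUnion_interior f (hmaps n)
  have hanti : Antitone Λn := antitone_nat_of_succ_le fun n => by
    rw [hΛn, hΛn]
    exact biUnion_iterate_subset (ht0 n) (hDdec n) (hself n)
  have hcpt n : IsCompact (Λn n) := hΛn n ▸
    (Finset.range (t n)).isCompact_biUnion fun k _ => (hDcpt n).image (f.continuous.iterate k)
  have hsub m n : Λ ⊆ (⇑f)^[m] '' Λn n := hΛ ▸
    (Set.iInter_subset _ m).trans (Set.image_mono (Set.iInter_subset _ n))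
  refine LyapunovStable.of_eq_iInter (L := fun n => (⇑f)^[n] '' Λn n) ?_ ?_
    (fun n => (hcpt n).image (f.continuous.iterate n)) ?_ fun n => ?_
  · refine (Set.subset_iInter fun n => hsub n n).antisymm ?_
    rw [hΛ]
    refine Set.subset_iInter fun m => ?_
    rw [Set.image_iInter (f.bijective.iterate m)]
    refine Set.subset_iInter fun n => (Set.iInter_subset _ (max m n)).trans ?_
    exact (antitone_iterate_image (hinv _) (le_max_left m n)).trans
      (Set.image_mono (hanti (le_max_right m n)))
  · exact fun m n hmn => (antitone_iterate_image (hinv n) hmn).trans (Set.image_mono (hanti hmn))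
  · rintro n _ ⟨y, hy, rfl⟩
    exact ⟨f y, hinv n hy, Function.Commute.iterate_self (⇑f) n y⟩
  · refine (hsub (n + t n) n).trans ?_
    rw [Function.iterate_add, Set.image_comp]
    exact (Set.image_mono (hint n).image_subset).trans
      ((f.isOpenMap.iterate n).image_interior_subset _)
end

section
/- Let f : X → X be a homeomorphism of a compact metric space X, let A ⊆ X be a closed set that is Lyapunov stable for f, and let T be a transitive set of f with T ∩ A ≠ ∅. Then T ⊆ A. -/
/-- A transitive set meeting a Lyapunov stable closed set is contained in it. -/
theorem transitive_subset_of_lyapunov_stable {X : Type*} [MetricSpace X] [CompactSpace X]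
    (f : X ≃ₜ X) (A : Set X) (hA : IsClosed A) (hstab : LyapunovStable f A)
    (T : Set X) (hT : IsTransitiveSet f T) (hmeet : (T ∩ A).Nonempty) :
    T ⊆ A := by
  intro x hxT
  by_contra hxA
  obtain ⟨U, W, hU, hW, hAU, hxW, hUW⟩ :=
    SeparatedNhds.of_isCompact_isClosed hA.isCompact isClosed_singleton
      (Set.disjoint_singleton_right.2 hxA)
  obtain ⟨V, hV, hAV, hVU⟩ := hstab U hU hAU
  obtain ⟨n, -, y, hyV, -, hyW⟩ := hT.2.2.2 V W hV hW
    (hmeet.mono (Set.inter_subset_inter_right T hAV)) ⟨x, hxT, hxW rfl⟩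
  exact hUW.notMem_of_mem_left (hVU n (Set.image_mono Set.inter_subset_right hyV)) hyW
end

section
/- Let f : X → X be a homeomorphism of a compact metric space X and let K be a transitive set of f that is Lyapunov stable for f and Lyapunov stable for f⁻¹. Then K is a saturated transitive set: every transitive set of f that intersects K is contained in K. -/
/-- A transitive set which is Lyapunov stable both for `f` and for `f⁻¹` is saturated:
every transitive set intersecting it is contained in it. -/
theorem bistable_transitive_is_saturated {X : Type*} [MetricSpace X] [CompactSpace X]
    (f : X ≃ₜ X) (K : Set X) (hK : IsTransitiveSet f K)
    (hstab : LyapunovStable f K) (hstab' : LyapunovStable f.symm K) :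
    ∀ T : Set X, IsTransitiveSet f T → (T ∩ K).Nonempty → T ⊆ K := by
  intro T hT ⟨x, hxT, hxK⟩ y hyT
  by_contra hyK
  obtain ⟨U, W, hU, hW, hKU, hyW, hUW⟩ :=
    SeparatedNhds.of_isCompact_isCompact hK.2.1 (isCompact_singleton (x := y))
      (Set.disjoint_singleton_right.2 hyK)
  obtain ⟨V, hV, hKV, hVU⟩ := hstab U hU hKU
  obtain ⟨n, -, z, hzV, -, hzW⟩ := hT.2.2.2 V W hV hW ⟨x, hxT, hKV hxK⟩ ⟨y, hyT, hyW rfl⟩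
  exact hUW.notMem_of_mem_left (hVU n (Set.image_mono Set.inter_subset_right hzV)) hzW
end
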